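/- Let μ_min be the unique root in [0, λ_1) of g(μ) = (μ - Σ_{i=0}^m q_i) - Σ_{i=1}^m λ_i q_i/(μ - λ_i), and let μ_- = (1/2)·(λ_1 + Σ_{i=0}^m q_i - √((λ_1 + Σ_{i=0}^m q_i)² - 4 λ_1 q_0)) be the smaller root of the quadratic (μ - Σ_{i=0}^m q_i)(μ - λ_1) - λ_1 Σ_{i=1}^m q_i. Then μ_- ≤ μ_min, with equality if and only if λ_i = λ_1 for all i. -/

import Mathlib

/-- The function `g` from the paper. -/
noncomputable def gFun (m : ℕ) (lam q : Fin m → ℝ) (q0 : ℝ) (μ : ℝ) : ℝ :=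
  (μ - (q0 + ∑ i, q i)) - ∑ i, lam i * q i / (μ - lam i)

/-- `μ₋ ≤ μ_min`, with equality iff all `λᵢ = λ₁`. Here `μ_min` is the unique root of
`g` in `[0, λ₁)` and `μ₋` is the smaller root of the quadratic
`(μ - ∑ᵢ qᵢ)(μ - λ₁) - λ₁ ∑_{i≥1} qᵢ`. -/
theorem mu_minus_le_mu_min (m : ℕ) (hm : 0 < m) (lam q : Fin m → ℝ) (q0 : ℝ)
    (hlam1 : 0 < lam ⟨0, hm⟩) (hsorted : Monotone lam)
    (hq : ∀ i, 0 < q i) (hq0 : 0 < q0)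
    (μmin : ℝ) (hμmin : μmin ∈ Set.Ico (0 : ℝ) (lam ⟨0, hm⟩))
    (hroot : gFun m lam q q0 μmin = 0)
    (μminus : ℝ)
    (hμminus : μminus = (1 / 2) * (lam ⟨0, hm⟩ + (q0 + ∑ i, q i) -
      Real.sqrt ((lam ⟨0, hm⟩ + (q0 + ∑ i, q i)) ^ 2 - 4 * lam ⟨0, hm⟩ * q0))) :
    μminus ≤ μmin ∧ (μminus = μmin ↔ ∀ i, lam i = lam ⟨0, hm⟩) := by
  obtain ⟨hx0, hxL⟩ := hμmin
  have hle : ∀ i, lam ⟨0, hm⟩ ≤ lam i := fun i => hsorted (Fin.mk_le_of_le_val (Nat.zero_le _))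
  unfold gFun at hroot
  set L := lam ⟨0, hm⟩ with hL
  set Q := ∑ i, q i with hQ
  have hQpos : 0 < Q := Finset.sum_pos (fun i _ => hq i) ⟨⟨0, hm⟩, Finset.mem_univ _⟩
  have hpos : ∀ i, 0 < lam i - μmin := fun i => by linarith [hle i]
  have hxpos : 0 < μmin := by
    rcases hx0.lt_or_eq with h | h
    · exact h
    · exfalso
      have hs : ∑ i, lam i * q i / (μmin - lam i) = -Q := by
        rw [hQ, ← Finset.sum_neg_distrib]
        refine Finset.sum_congr rfl fun i _ => ?_
        have h1 : lam i ≠ 0 := (lt_of_lt_of_le hlam1 (hle i)).ne'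
        rw [← h]
        field_simp
        ring
      rw [hs] at hroot
      linarith
  have hE : ∑ i, q i * μmin * (lam i - L) / (lam i - μmin)
      = L * Q + (L - μmin) * (μmin - (q0 + Q)) := by
    have h2 : μmin - (q0 + Q) = ∑ i, lam i * q i / (μmin - lam i) := by linarith
    rw [h2, hQ, Finset.mul_sum, Finset.mul_sum, ← Finset.sum_add_distrib]
    refine Finset.sum_congr rfl fun i _ => ?_
    have h1 := (hpos i).ne'
    have h3 : μmin - lam i ≠ 0 := by
      have := hpos i
      intro h
      linarith
    field_simp
    ring
  have hEnn : ∀ i ∈ Finset.univ, 0 ≤ q i * μmin * (lam i - L) / (lam i - μmin) := fun i _ =>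
    div_nonneg (mul_nonneg (mul_pos (hq i) hxpos).le (by linarith [hle i])) (hpos i).le
  have hsum := Finset.sum_nonneg hEnn
  have hzero := Finset.sum_eq_zero_iff_of_nonneg hEnn
  rw [hE] at hsum hzero
  have hDnn : 0 ≤ (L + (q0 + Q)) ^ 2 - 4 * L * q0 := by
    nlinarith [sq_nonneg (L - (q0 + Q)), mul_pos hlam1 hQpos]
  refine ⟨?_, ?_, ?_⟩
  · have : L + (q0 + Q) - 2 * μmin ≤ √((L + (q0 + Q)) ^ 2 - 4 * L * q0) := by
      apply Real.le_sqrt_of_sq_le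
      nlinarith
    linarith
  · intro h i
    have h1 : √((L + (q0 + Q)) ^ 2 - 4 * L * q0) = L + (q0 + Q) - 2 * μmin := by linarith
    have h2 := Real.sq_sqrt hDnn
    rw [h1] at h2
    have h3 := hzero.1 (by nlinarith) i (Finset.mem_univ _)
    rw [div_eq_zero_iff] at h3
    rcases h3 with h3 | h3
    · rcases mul_eq_zero.1 h3 with h4 | h4
      · exact absurd h4 (mul_pos (hq i) hxpos).ne'
      · linarith
    · exact absurd h3 (hpos i).ne'
  · intro h
    have h3 := hzero.2 (fun i _ => by rw [h i]; simp)
    have hS : μmin < q0 + Q := by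
      by_contra hc
      have h4 := mul_nonneg (sub_nonneg.2 hxL.le) (sub_nonneg.2 (not_lt.1 hc))
      nlinarith [mul_pos hlam1 hQpos]
    have h5 : √((L + (q0 + Q)) ^ 2 - 4 * L * q0) = L + (q0 + Q) - 2 * μmin := by
      rw [Real.sqrt_eq_iff_mul_self_eq hDnn (by linarith)]
      nlinarith
    rw [hμminus, h5]
    ring
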